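/- arXiv:1708.04832 — 2 statements merged into one kernel-verified Lean document; each statement's English description precedes it below -/
import Mathlib

section
/- The generalized shift dynamical system (X^Γ, σ_φ) is ω_u^u-chaotic (resp. ω^u_∞-chaotic, ω^u_2-chaotic, ω_∞^∞-chaotic, ω_2^∞-chaotic) if and only if φ : Γ → Γ has at least one non-quasi-periodic point; in particular all five ω-chaos properties of (X^Γ, σ_φ) are equivalent to the existence of a non-quasi-periodic point of φ. -/
open Filter Topology

/-- `d : Y → Y → ℝ` is a metric on the topological space `Y` compatible with
(i.e. inducing) its topology. -/
def IsCompatibleMetric (Y : Type*) [t : TopologicalSpace Y] (d : Y → Y → ℝ) : Prop :=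
  ∃ m : MetricSpace Y, m.toUniformSpace.toTopologicalSpace = t ∧ ∀ a b, m.dist a b = d a b

/-- The generalized shift `σ_φ : X^Γ → X^Γ`, `σ_φ((x_α)_α) = (x_{φ(α)})_α`. -/
def genShift {X Γ : Type*} (φ : Γ → Γ) (x : Γ → X) : Γ → X := fun α => x (φ α)

/-- `θ` is a quasi-periodic point of `φ` iff its forward orbit `{φ^n(θ) : n ≥ 0}` is finite. -/
def QuasiPeriodic {Γ : Type*} (φ : Γ → Γ) (θ : Γ) : Prop :=
  (Set.range fun n : ℕ => φ^[n] θ).Finite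

/-- `θ` is a periodic point of `φ` iff `φ^n(θ) = θ` for some `n ≥ 1`. -/
def PeriodicPt {Γ : Type*} (φ : Γ → Γ) (θ : Γ) : Prop := ∃ n ≥ 1, φ^[n] θ = θ

/-- `ξ(x,y,t,n) = #{i ∈ {0,…,n−1} : d(f^i(x), f^i(y)) < t}`. -/
noncomputable def xiCount {Y : Type*} (d : Y → Y → ℝ) (f : Y → Y) (x y : Y) (t : ℝ) (n : ℕ) :
    ℕ :=
  {i : ℕ | i < n ∧ d (f^[i] x) (f^[i] y) < t}.ncard

/-- `F_{xy}(t) = liminf_n ξ(x,y,t,n)/n`. -/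
noncomputable def Fdist {Y : Type*} (d : Y → Y → ℝ) (f : Y → Y) (x y : Y) (t : ℝ) : ℝ :=
  liminf (fun n : ℕ => (xiCount d f x y t n : ℝ) / n) atTop

/-- `F*_{xy}(t) = limsup_n ξ(x,y,t,n)/n`. -/
noncomputable def FdistStar {Y : Type*} (d : Y → Y → ℝ) (f : Y → Y) (x y : Y) (t : ℝ) : ℝ :=
  limsup (fun n : ℕ => (xiCount d f x y t n : ℝ) / n) atTop

/-- `ζ(x,y,γ_D,n) = #{i ∈ {0,…,n−1} : (f^i(x), f^i(y)) ∈ γ_D}` where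
`γ_D = {(u,v) : u_α = v_α for all α ∈ D}`. -/
noncomputable def zetaCount {X Γ : Type*} (f : (Γ → X) → (Γ → X)) (x y : Γ → X) (D : Set Γ)
    (n : ℕ) : ℕ :=
  {i : ℕ | i < n ∧ ∀ α ∈ D, f^[i] x α = f^[i] y α}.ncard

/-- `G_{xy}(γ_D) = liminf_n ζ(x,y,γ_D,n)/n`. -/
noncomputable def Gdist {X Γ : Type*} (f : (Γ → X) → (Γ → X)) (x y : Γ → X) (D : Set Γ) : ℝ :=
  liminf (fun n : ℕ => (zetaCount f x y D n : ℝ) / n) atTop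

/-- `G*_{xy}(γ_D) = limsup_n ζ(x,y,γ_D,n)/n`. -/
noncomputable def GdistStar {X Γ : Type*} (f : (Γ → X) → (Γ → X)) (x y : Γ → X) (D : Set Γ) :
    ℝ :=
  limsup (fun n : ℕ => (zetaCount f x y D n : ℝ) / n) atTop

/-- `x, y` are distributionally scrambled of type 1 (w.r.t. the metric `d` and the map `f`). -/
def DistScrambled1 {Y : Type*} (d : Y → Y → ℝ) (f : Y → Y) (x y : Y) : Prop :=
  (∃ s > 0, Fdist d f x y s = 0) ∧ ∀ s > 0, FdistStar d f x y s = 1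

/-- `x, y` are distributionally scrambled of type 2. -/
def DistScrambled2 {Y : Type*} (d : Y → Y → ℝ) (f : Y → Y) (x y : Y) : Prop :=
  (∃ s > 0, Fdist d f x y s < 1) ∧ ∀ s > 0, FdistStar d f x y s = 1

/-- `x, y` are distributionally scrambled of type 3. -/
def DistScrambled3 {Y : Type*} (d : Y → Y → ℝ) (f : Y → Y) (x y : Y) : Prop :=
  ∃ a b : ℝ, 0 < a ∧ a < b ∧ ∀ s ∈ Set.Icc a b, Fdist d f x y s < FdistStar d f x y s

/-- `A` is a distributionally scrambled set of type 1: it has at least two elements and all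
pairs of distinct points of `A` are distributionally scrambled of type 1. -/
def DistScrambledSet1 {Y : Type*} (d : Y → Y → ℝ) (f : Y → Y) (A : Set Y) : Prop :=
  A.Nontrivial ∧ ∀ x ∈ A, ∀ y ∈ A, x ≠ y → DistScrambled1 d f x y

/-- `A` is a distributionally scrambled set of type 2. -/
def DistScrambledSet2 {Y : Type*} (d : Y → Y → ℝ) (f : Y → Y) (A : Set Y) : Prop :=
  A.Nontrivial ∧ ∀ x ∈ A, ∀ y ∈ A, x ≠ y → DistScrambled2 d f x y

/-- `A` is a distributionally scrambled set of type 3. -/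
def DistScrambledSet3 {Y : Type*} (d : Y → Y → ℝ) (f : Y → Y) (A : Set Y) : Prop :=
  A.Nontrivial ∧ ∀ x ∈ A, ∀ y ∈ A, x ≠ y → DistScrambled3 d f x y

/-- `(Y,f)` is uniform distributionally chaotic: there is an uncountable distributionally
scrambled set `A` of type 1 and a single `ε > 0` with `F_{xy}(ε) = 0` for distinct `x,y ∈ A`. -/
def UniformDC {Y : Type*} (d : Y → Y → ℝ) (f : Y → Y) : Prop :=
  ∃ A : Set Y, ¬ A.Countable ∧ DistScrambledSet1 d f A ∧
    ∃ ε > 0, ∀ x ∈ A, ∀ y ∈ A, x ≠ y → Fdist d f x y ε = 0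

/-- `a` is a transitive point of `f`: its forward orbit is dense. -/
def TransitivePoint {Y : Type*} [TopologicalSpace Y] (f : Y → Y) (a : Y) : Prop :=
  Dense (Set.range fun n : ℕ => f^[n] a)

/-- `(Y,f)` is dense distributionally chaotic: uniform distributional chaos witnessed by a
dense set. -/
def DenseDC {Y : Type*} [TopologicalSpace Y] (d : Y → Y → ℝ) (f : Y → Y) : Prop :=
  ∃ A : Set Y, ¬ A.Countable ∧ Dense A ∧ DistScrambledSet1 d f A ∧
    ∃ ε > 0, ∀ x ∈ A, ∀ y ∈ A, x ≠ y → Fdist d f x y ε = 0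

/-- `(Y,f)` is transitive distributionally chaotic: uniform distributional chaos witnessed by a
dense set of transitive points. -/
def TransitiveDC {Y : Type*} [TopologicalSpace Y] (d : Y → Y → ℝ) (f : Y → Y) : Prop :=
  ∃ A : Set Y, ¬ A.Countable ∧ Dense A ∧ (∀ a ∈ A, TransitivePoint f a) ∧
    DistScrambledSet1 d f A ∧
    ∃ ε > 0, ∀ x ∈ A, ∀ y ∈ A, x ≠ y → Fdist d f x y ε = 0

/-- The ω-limit set of `a` under `f`: all limits of `f^[n k] a` along strictly increasing
sequences `n`. -/
def OmegaSet {Y : Type*} [TopologicalSpace Y] (f : Y → Y) (a : Y) : Set Y :=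
  {z | ∃ n : ℕ → ℕ, StrictMono n ∧ Tendsto (fun k => f^[n k] a) atTop (nhds z)}

/-- The set of periodic points of `f`. -/
def PerSet {Y : Type*} (f : Y → Y) : Set Y := {y | ∃ n ≥ 1, f^[n] y = y}

/-- `x, y` are `ω^u`-scrambled. -/
def OmegaUScrambled {Y : Type*} [TopologicalSpace Y] (f : Y → Y) (x y : Y) : Prop :=
  ¬ (OmegaSet f x \ OmegaSet f y).Countable ∧
    (OmegaSet f x ∩ OmegaSet f y).Nonempty ∧ (OmegaSet f x \ PerSet f).Nonempty

/-- `x, y` are `ω^∞`-scrambled. -/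
def OmegaInfScrambled {Y : Type*} [TopologicalSpace Y] (f : Y → Y) (x y : Y) : Prop :=
  (OmegaSet f x \ OmegaSet f y).Infinite ∧
    (OmegaSet f x ∩ OmegaSet f y).Nonempty ∧ (OmegaSet f x \ PerSet f).Nonempty

/-- `A` is an `ω^u`-scrambled set. -/
def OmegaUScrambledSet {Y : Type*} [TopologicalSpace Y] (f : Y → Y) (A : Set Y) : Prop :=
  A.Nontrivial ∧ ∀ x ∈ A, ∀ y ∈ A, x ≠ y → OmegaUScrambled f x y

/-- `A` is an `ω^∞`-scrambled set. -/
def OmegaInfScrambledSet {Y : Type*} [TopologicalSpace Y] (f : Y → Y) (A : Set Y) : Prop :=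
  A.Nontrivial ∧ ∀ x ∈ A, ∀ y ∈ A, x ≠ y → OmegaInfScrambled f x y

/-! ### Iterates and `ω`-limit sets of generalized shifts -/

theorem genShift_iterate_apply {X Γ : Type*} (φ : Γ → Γ) (n : ℕ) (x : Γ → X) (α : Γ) :
    (genShift φ)^[n] x α = x (φ^[n] α) := by
  induction n generalizing α with
  | zero => rfl
  | succ n ih =>
    rw [Function.iterate_succ_apply', Function.iterate_succ_apply]
    exact ih (φ α)

/-- Points of the orbit of a non-quasi-periodic point are pairwise distinct. -/
theorem iterate_injective_of_not_quasiPeriodic {Γ : Type*} {φ : Γ → Γ} {θ : Γ}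
    (h : ¬ QuasiPeriodic φ θ) : Function.Injective fun n : ℕ => φ^[n] θ := by
  suffices hne : ∀ i j : ℕ, i < j → φ^[i] θ ≠ φ^[j] θ by
    intro i j heq
    by_contra hij
    rcases lt_or_gt_of_ne hij with hlt | hlt
    · exact hne i j hlt heq
    · exact hne j i hlt heq.symm
  intro i j hij heq
  refine h (Set.Finite.subset ((Set.finite_Iio j).image fun n => φ^[n] θ) ?_)
  rintro _ ⟨n, rfl⟩
  induction n using Nat.strong_induction_on with
  | _ n ih =>
    by_cases hn : n < j
    · exact ⟨n, hn, rfl⟩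
    · have : φ^[n] θ = φ^[n - j + i] θ := by
        conv_lhs => rw [show n = n - j + j by omega, Function.iterate_add_apply]
        rw [Function.iterate_add_apply]
        exact congrArg _ heq.symm
      simp only [this]
      exact ih _ (by omega)

/-- Convergence in a power of a discrete space is coordinatewise eventual equality. -/
theorem tendsto_pi_discrete {X Γ ι : Type*} [TopologicalSpace X] [DiscreteTopology X]
    {l : Filter ι} {u : ι → Γ → X} {z : Γ → X} :
    Tendsto u l (𝓝 z) ↔ ∀ α, ∀ᶠ k in l, u k α = z α := by
  rw [tendsto_pi_nhds]
  refine forall_congr' fun α => ?_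
  rw [nhds_discrete, tendsto_pure]

/-- Along any sequence of times tending to infinity, some `ω`-limit point of `x` takes at every
coordinate the eventual value of the orbit, whenever there is one. -/
theorem exists_mem_omegaSet_of_tendsto {X Γ : Type*} [Finite X] [TopologicalSpace X]
    [DiscreteTopology X] [Countable Γ] (f : (Γ → X) → (Γ → X)) (x : Γ → X) {N : ℕ → ℕ}
    (hN : Tendsto N atTop atTop) :
    ∃ z ∈ OmegaSet f x, ∀ α c, (∀ᶠ j in atTop, f^[N j] x α = c) → z α = c := by
  obtain ⟨ψ, hψ₀, hψ⟩ := strictMono_subseq_of_tendsto_atTop hN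
  obtain ⟨z, χ, hχ, hz⟩ := CompactSpace.tendsto_subseq fun k => f^[N (ψ k)] x
  have hψχ : StrictMono (N ∘ ψ ∘ χ) := hψ.comp hχ
  refine ⟨z, ⟨_, hψχ, hz⟩, fun α c hc => ?_⟩
  have hlim : Tendsto (fun k => ψ (χ k)) atTop atTop := (hψ₀.comp hχ).tendsto_atTop
  obtain ⟨k, hk, hk'⟩ :=
    ((hlim.eventually hc).and (tendsto_pi_discrete.1 hz α)).exists
  exact hk'.symm.trans hk

/-- If every point of `Γ` is quasi-periodic then intersecting `ω`-limit sets coincide. -/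
theorem omegaSet_subset_of_inter_nonempty {X Γ : Type*} [TopologicalSpace X]
    [DiscreteTopology X] [Countable Γ] {φ : Γ → Γ} (h : ∀ θ, QuasiPeriodic φ θ) {x y : Γ → X}
    (hxy : (OmegaSet (genShift φ) x ∩ OmegaSet (genShift φ) y).Nonempty) :
    OmegaSet (genShift φ) x ⊆ OmegaSet (genShift φ) y := by
  obtain ⟨z, ⟨a, -, ha⟩, ⟨b, -, hb⟩⟩ := hxy
  rintro w ⟨c, hc, hw⟩
  suffices hcl : MapClusterPt w atTop fun n => (genShift φ)^[n] y by
    obtain ⟨ψ, hψ, hψw⟩ := hcl.tendsto_subseq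
    exact ⟨ψ, hψ, hψw⟩
  rw [mapClusterPt_iff_frequently]
  intro s hs
  rw [nhds_pi, Filter.mem_pi] at hs
  obtain ⟨D, hD, t, ht, hts⟩ := hs
  let E : Set Γ := ⋃ α ∈ D, Set.range fun n : ℕ => φ^[n] α
  have hE : E.Finite := hD.biUnion fun α _ => h α
  have hev : ∀ {u : ℕ → Γ → X} {v : Γ → X}, Tendsto u atTop (𝓝 v) →
      ∀ᶠ k in atTop, ∀ α ∈ E, u k α = v α := fun hu =>
    (Filter.eventually_all_finite hE).2 fun α _ => tendsto_pi_discrete.1 hu α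
  obtain ⟨k, hak, hbk⟩ := ((hev ha).and (hev hb)).exists
  rw [frequently_atTop]
  intro M
  obtain ⟨l, hl, hlM⟩ := ((hev hw).and (hc.tendsto_atTop.eventually_ge_atTop (a k + M))).exists
  refine ⟨c l - a k + b k, by omega, hts fun α hα => ?_⟩
  have hmem : ∀ n, φ^[n] α ∈ E := fun n => Set.mem_biUnion hα ⟨n, rfl⟩
  have heq : (genShift φ)^[c l - a k + b k] y α = w α := by
    rw [genShift_iterate_apply, ← hl α (hmem 0), genShift_iterate_apply,
      show c l - a k + b k = b k + (c l - a k) by omega,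
      show φ^[c l] α = φ^[a k + (c l - a k)] α by congr 2; omega,
      Function.iterate_add_apply, Function.iterate_add_apply, ← genShift_iterate_apply φ (b k) y,
      ← genShift_iterate_apply φ (a k) x, hbk _ (hmem _), hak _ (hmem _)]
  rw [heq]
  exact mem_of_mem_nhds (ht α)

theorem exists_not_quasiPeriodic_of_omegaInfScrambledSet {X Γ : Type*} [TopologicalSpace X]
    [DiscreteTopology X] [Countable Γ] {φ : Γ → Γ} {A : Set (Γ → X)}
    (hA : OmegaInfScrambledSet (genShift φ) A) : ∃ θ, ¬ QuasiPeriodic φ θ := by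
  by_contra! h
  obtain ⟨⟨x, hx, y, hy, hne⟩, hs⟩ := hA
  obtain ⟨hinf, hint, -⟩ := hs x hx y hy hne
  rw [Set.sdiff_eq_empty.2 (omegaSet_subset_of_inter_nonempty h hint)] at hinf
  exact hinf Set.finite_empty

theorem OmegaUScrambledSet.omegaInfScrambledSet {Y : Type*} [TopologicalSpace Y] {f : Y → Y}
    {A : Set Y} (hA : OmegaUScrambledSet f A) : OmegaInfScrambledSet f A :=
  ⟨hA.1, fun x hx y hy hne =>
    let ⟨h₁, h₂⟩ := hA.2 x hx y hy hne
    ⟨fun hfin => h₁ hfin.countable, h₂⟩⟩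

theorem not_countable_range_of_injective {Y : Type*} {f : Set ℕ → Y}
    (hf : Function.Injective f) : ¬ (Set.range f).Countable := by
  intro hc
  have : Countable (Set ℕ) := by
    have := hc.to_subtype
    exact (Set.rangeFactorization_injective.2 hf).countable
  obtain ⟨e, he⟩ := exists_injective_nat (Set ℕ)
  exact Function.cantor_injective e he

/-! ### Sets of naturals with prescribed local patterns -/

/-- All positive differences of elements of `Z` have a label in `S`. The label of `d` is the
first component of the pair coded by the base-4 upper logarithm of `d`. -/
def DiffLabelsIn (S Z : Set ℕ) : Prop :=
  ∀ i ∈ Z, ∀ j ∈ Z, i < j → (Nat.unpair (Nat.clog 4 (j - i))).1 ∈ S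

/-- An enumeration of the finite sets of naturals in which each one occurs infinitely often. -/
def finsetSeq (k : ℕ) : Finset ℕ := (Denumerable.eqv (Finset ℕ)).symm k.unpair.1

/-- The set of naturals whose trace on `[k², (k+1)²)` is `k² + finsetSeq k` if
`finsetSeq k` is contained in `[0, k]` and has difference labels in `S`, and is empty otherwise. -/
def patternSet (S : Set ℕ) : Set ℕ :=
  {i | i - i.sqrt * i.sqrt ∈ finsetSeq i.sqrt ∧ (∀ j ∈ finsetSeq i.sqrt, j ≤ i.sqrt) ∧
    DiffLabelsIn S (finsetSeq i.sqrt)}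

theorem sq_add_mem_patternSet_iff {S : Set ℕ} {k j : ℕ} (hj : j ≤ 2 * k) :
    k * k + j ∈ patternSet S ↔
      j ∈ finsetSeq k ∧ (∀ i ∈ finsetSeq k, i ≤ k) ∧ DiffLabelsIn S (finsetSeq k) := by
  have hs : (k * k + j).sqrt = k := Nat.sqrt_add_eq k (by omega)
  simp only [patternSet, Set.mem_ofPred_eq, hs, Nat.add_sub_cancel_left]

theorem sq_add_notMem_patternSet {S : Set ℕ} {k j : ℕ} (hk : k < j) (hj : j ≤ 2 * k) :
    k * k + j ∉ patternSet S := by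
  rw [sq_add_mem_patternSet_iff hj]
  rintro ⟨h₁, h₂, -⟩
  exact absurd (h₂ j h₁) (by omega)

theorem label_mem_of_mem_patternSet {S : Set ℕ} {n g : ℕ} (hg : 0 < g)
    (hgn : (g + 1) * (g + 1) ≤ n) (hn : n ∈ patternSet S) (hng : n + g ∈ patternSet S) :
    (Nat.unpair (Nat.clog 4 g)).1 ∈ S := by
  obtain ⟨k, j, hj, rfl⟩ : ∃ k j, j ≤ 2 * k ∧ n = k * k + j := by
    refine ⟨n.sqrt, n - n.sqrt * n.sqrt, ?_, ?_⟩
    · have := Nat.sqrt_le_add n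
      omega
    · have := Nat.sqrt_le n
      omega
  have hgk : g < k := by
    by_contra! hle
    have := Nat.mul_le_mul hle hle
    nlinarith
  obtain ⟨h₁, h₂, h₃⟩ := (sq_add_mem_patternSet_iff hj).1 hn
  have hjk := h₂ j h₁
  rw [add_assoc, sq_add_mem_patternSet_iff (by omega)] at hng
  simpa using h₃ j h₁ (j + g) hng.1 (by omega)

/-- Every set with difference labels in `S` is approximated by translates of `patternSet S`. -/
theorem exists_tendsto_patternSet {S Z : Set ℕ} (hZ : DiffLabelsIn S Z) :
    ∃ N : ℕ → ℕ, Tendsto N atTop atTop ∧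
      ∀ i, ∀ᶠ j in atTop, (N j + i ∈ patternSet S ↔ i ∈ Z) := by
  classical
  let F : ℕ → Finset ℕ := fun j => (Finset.range (j + 1)).filter (· ∈ Z)
  let K : ℕ → ℕ := fun j => Nat.pair (Denumerable.eqv (Finset ℕ) (F j)) j
  have hFK : ∀ j, finsetSeq (K j) = F j := fun j => by simp [finsetSeq, K]
  have hK : ∀ j, j ≤ K j := fun j => Nat.right_le_pair _ _
  refine ⟨fun j => K j * K j, ?_, fun i => ?_⟩
  · exact tendsto_atTop_mono (fun j => (hK j).trans (Nat.le_mul_self _)) tendsto_id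
  · filter_upwards [eventually_ge_atTop i] with j hj
    have := hK j
    rw [sq_add_mem_patternSet_iff (by omega), hFK]
    constructor
    · rintro ⟨h, -⟩
      exact (Finset.mem_filter.1 h).2
    · intro h
      refine ⟨Finset.mem_filter.2 ⟨Finset.mem_range.2 (by omega), h⟩, fun l hl => ?_, ?_⟩
      · have := Finset.mem_range.1 (Finset.mem_filter.1 hl).1
        omega
      · intro a ha b hb
        exact hZ a (Finset.mem_filter.1 ha).2 b (Finset.mem_filter.1 hb).2

/-- A set all of whose differences have label `n`, encoding `W`. -/
def labelledSet (n : ℕ) (W : Set ℕ) : Set ℕ :=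
  insert 0 ((fun j => 4 ^ Nat.pair n j) '' insert 0 (Nat.succ '' W))

theorem zero_mem_labelledSet (n : ℕ) (W : Set ℕ) : 0 ∈ labelledSet n W := Set.mem_insert _ _

theorem pow_zero_mem_labelledSet (n : ℕ) (W : Set ℕ) : 4 ^ Nat.pair n 0 ∈ labelledSet n W :=
  Set.mem_insert_of_mem _ ⟨0, Set.mem_insert _ _, rfl⟩

theorem pow_succ_mem_labelledSet_iff {n w : ℕ} {W : Set ℕ} :
    4 ^ Nat.pair n (w + 1) ∈ labelledSet n W ↔ w ∈ W := by
  simp [labelledSet, Nat.pair_eq_pair]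

theorem clog_four_pow_sub_pow {a b : ℕ} (h : a < b) : Nat.clog 4 (4 ^ b - 4 ^ a) = b := by
  obtain ⟨c, rfl⟩ : ∃ c, b = c + 1 := ⟨b - 1, by omega⟩
  have h₁ : 4 ^ a ≤ 4 ^ c := Nat.pow_le_pow_right (by norm_num) (by omega)
  have h₂ : 0 < 4 ^ c := by positivity
  have h₃ : 4 ^ (c + 1) = 4 * 4 ^ c := by ring
  apply le_antisymm
  · exact Nat.clog_le_of_le_pow (Nat.sub_le _ _)
  · rw [Nat.succ_le_iff, Nat.lt_clog_iff_pow_lt (by norm_num)]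
    omega

theorem diffLabelsIn_labelledSet {S : Set ℕ} {n : ℕ} (hn : n ∈ S) (W : Set ℕ) :
    DiffLabelsIn S (labelledSet n W) := by
  rintro i hi j (rfl | ⟨b, -, rfl⟩) hij
  · omega
  · rcases hi with rfl | ⟨a, -, rfl⟩
    · simpa using hn
    · have hab : Nat.pair n a < Nat.pair n b := (Nat.pow_lt_pow_iff_right (by norm_num)).1 hij
      simpa [clog_four_pow_sub_pow hab] using hn

/-! ### Points of `X^Γ` supported on the orbit of a non-quasi-periodic point -/

section OrbitPoint

variable {X Γ : Type*}

open Classical in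
/-- The point equal to `q` at `φ^i(θ)` for `i ∈ U`, and to `p` elsewhere. -/
noncomputable def orbitPoint (φ : Γ → Γ) (θ : Γ) (p q : X) (U : Set ℕ) : Γ → X :=
  fun α => if ∃ i ∈ U, φ^[i] θ = α then q else p

theorem orbitPoint_iterate_of_mem {φ : Γ → Γ} {θ : Γ} {p q : X} {U : Set ℕ} {i : ℕ}
    (hi : i ∈ U) : orbitPoint φ θ p q U (φ^[i] θ) = q :=
  if_pos ⟨i, hi, rfl⟩

theorem orbitPoint_iterate_of_notMem {φ : Γ → Γ} {θ : Γ} (h : ¬ QuasiPeriodic φ θ) {p q : X}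
    {U : Set ℕ} {i : ℕ} (hi : i ∉ U) : orbitPoint φ θ p q U (φ^[i] θ) = p := by
  refine if_neg ?_
  rintro ⟨j, hj, hji⟩
  exact hi (iterate_injective_of_not_quasiPeriodic h hji ▸ hj)

theorem orbitPoint_iterate_eq_iff {φ : Γ → Γ} {θ : Γ} (h : ¬ QuasiPeriodic φ θ) {p q : X}
    (hpq : p ≠ q) {U : Set ℕ} {i : ℕ} : orbitPoint φ θ p q U (φ^[i] θ) = q ↔ i ∈ U := by
  by_cases hi : i ∈ U
  · simp [orbitPoint_iterate_of_mem hi, hi]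
  · simp [orbitPoint_iterate_of_notMem h hi, hi, hpq]

variable [TopologicalSpace X] [DiscreteTopology X] {φ : Γ → Γ} {θ : Γ} {p q : X} {S : Set ℕ}

theorem exists_mem_omegaSet_orbitPoint [Finite X] [Countable Γ] (h : ¬ QuasiPeriodic φ θ) (hpq : p ≠ q)
    {Z : Set ℕ} (hZ : DiffLabelsIn S Z) :
    ∃ z ∈ OmegaSet (genShift φ) (orbitPoint φ θ p q (patternSet S)),
      ∀ i, z (φ^[i] θ) = q ↔ i ∈ Z := by
  obtain ⟨N, hN, hNZ⟩ := exists_tendsto_patternSet hZ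
  obtain ⟨z, hz, hzN⟩ := exists_mem_omegaSet_of_tendsto (genShift φ)
    (orbitPoint φ θ p q (patternSet S)) hN
  refine ⟨z, hz, fun i => ?_⟩
  by_cases hi : i ∈ Z
  · refine iff_of_true (hzN _ q ?_) hi
    filter_upwards [hNZ i] with j hj
    rw [genShift_iterate_apply, ← Function.iterate_add_apply]
    exact orbitPoint_iterate_of_mem (hj.2 hi)
  · have hp : z (φ^[i] θ) = p := by
      refine hzN _ p ?_
      filter_upwards [hNZ i] with j hj
      rw [genShift_iterate_apply, ← Function.iterate_add_apply]
      exact orbitPoint_iterate_of_notMem h (mt hj.1 hi)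
    exact iff_of_false (by rwa [hp]) hi

theorem const_mem_omegaSet_orbitPoint [Finite X] [Countable Γ] (h : ¬ QuasiPeriodic φ θ) :
    (fun _ => p) ∈ OmegaSet (genShift φ) (orbitPoint φ θ p q (patternSet S)) := by
  obtain ⟨z, hz, hzN⟩ := exists_mem_omegaSet_of_tendsto (genShift φ)
    (orbitPoint φ θ p q (patternSet S)) (N := fun j => j * j + (j + 1 + j / 2))
    (tendsto_atTop_mono (fun j => by simp only [id]; omega) tendsto_id)
  convert hz
  refine (hzN _ p ?_).symm
  rename_i α
  by_cases hα : ∃ m n, φ^[m] α = φ^[n] θ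
  · obtain ⟨m, n, hmn⟩ := hα
    filter_upwards [eventually_ge_atTop (2 * (m + n) + 2)] with j hj
    rw [genShift_iterate_apply,
      show j * j + (j + 1 + j / 2) = j * j + (j + 1 + j / 2 - m) + m by omega,
      Function.iterate_add_apply, hmn, ← Function.iterate_add_apply, add_assoc]
    exact orbitPoint_iterate_of_notMem h (sq_add_notMem_patternSet (by omega) (by omega))
  · refine Eventually.of_forall fun j => ?_
    rw [genShift_iterate_apply]
    refine if_neg ?_
    rintro ⟨i, -, hi⟩
    exact hα ⟨_, i, hi.symm⟩

theorem label_mem_of_mem_omegaSet_orbitPoint (h : ¬ QuasiPeriodic φ θ) (hpq : p ≠ q)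
    {z : Γ → X} (hz : z ∈ OmegaSet (genShift φ) (orbitPoint φ θ p q (patternSet S))) {g : ℕ}
    (hg : 0 < g) (h0 : z θ = q) (hzg : z (φ^[g] θ) = q) :
    (Nat.unpair (Nat.clog 4 g)).1 ∈ S := by
  obtain ⟨n, hn, hlim⟩ := hz
  rw [tendsto_pi_discrete] at hlim
  obtain ⟨k, ⟨h₁, h₂⟩, h₃⟩ := (((hlim θ).and (hlim (φ^[g] θ))).and
    (hn.tendsto_atTop.eventually_ge_atTop ((g + 1) * (g + 1)))).exists
  rw [genShift_iterate_apply, h0, orbitPoint_iterate_eq_iff h hpq] at h₁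
  rw [genShift_iterate_apply, hzg, ← Function.iterate_add_apply,
    orbitPoint_iterate_eq_iff h hpq] at h₂
  exact label_mem_of_mem_patternSet hg h₃ h₁ h₂

theorem omegaSet_orbitPoint_diff_perSet_nonempty [Finite X] [Countable Γ] (h : ¬ QuasiPeriodic φ θ)
    (hpq : p ≠ q) :
    (OmegaSet (genShift φ) (orbitPoint φ θ p q (patternSet S)) \
      PerSet (genShift φ)).Nonempty := by
  have hZ : DiffLabelsIn S {0} := by
    rintro i rfl j rfl hij
    omega
  obtain ⟨z, hz, hz0⟩ := exists_mem_omegaSet_orbitPoint h hpq hZ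
  refine ⟨z, hz, ?_⟩
  rintro ⟨n, hn, hzn⟩
  have hθ : z (φ^[n] θ) = q := by
    rw [← genShift_iterate_apply φ n z, hzn]
    exact (hz0 0).2 rfl
  have : n = 0 := (hz0 n).1 hθ
  omega

theorem not_countable_omegaSet_orbitPoint_diff [Finite X] [Countable Γ] (h : ¬ QuasiPeriodic φ θ)
    (hpq : p ≠ q) {T : Set ℕ} (hST : ¬ S ⊆ T) :
    ¬ (OmegaSet (genShift φ) (orbitPoint φ θ p q (patternSet S)) \
      OmegaSet (genShift φ) (orbitPoint φ θ p q (patternSet T))).Countable := by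
  obtain ⟨n, hnS, hnT⟩ := Set.not_subset.1 hST
  choose z hz hzW using fun W : Set ℕ =>
    exists_mem_omegaSet_orbitPoint h hpq (diffLabelsIn_labelledSet hnS W)
  have hinj : Function.Injective z := by
    intro V W hVW
    ext w
    rw [← pow_succ_mem_labelledSet_iff (n := n), ← hzW, hVW, hzW, pow_succ_mem_labelledSet_iff]
  intro hc
  have hrange : (Set.range z).Countable := by
    refine hc.mono ?_
    rintro _ ⟨W, rfl⟩
    refine ⟨hz W, fun hT => hnT ?_⟩
    simpa using label_mem_of_mem_omegaSet_orbitPoint h hpq hT (by positivity)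
      ((hzW W 0).2 (zero_mem_labelledSet n W)) ((hzW W _).2 (pow_zero_mem_labelledSet n W))
  exact not_countable_range_of_injective hinj hrange

theorem omegaUScrambled_orbitPoint [Finite X] [Countable Γ] (h : ¬ QuasiPeriodic φ θ) (hpq : p ≠ q)
    {T : Set ℕ} (hST : ¬ S ⊆ T) :
    OmegaUScrambled (genShift φ) (orbitPoint φ θ p q (patternSet S))
      (orbitPoint φ θ p q (patternSet T)) :=
  ⟨not_countable_omegaSet_orbitPoint_diff h hpq hST,
    ⟨_, const_mem_omegaSet_orbitPoint h, const_mem_omegaSet_orbitPoint h⟩,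
    omegaSet_orbitPoint_diff_perSet_nonempty h hpq⟩

/-- Distinct sets of naturals are sent to incomparable ones. -/
def antichainSet (A : Set ℕ) : Set ℕ := {m | m / 2 ∈ A ↔ m % 2 = 0}

theorem not_antichainSet_subset {A B : Set ℕ} (hAB : A ≠ B) :
    ¬ antichainSet A ⊆ antichainSet B := by
  intro hsub
  apply hAB
  ext n
  have h₀ := @hsub (2 * n)
  have h₁ := @hsub (2 * n + 1)
  have e₁ : (2 * n + 1) / 2 = n := by omega
  have e₂ : (2 * n + 1) % 2 = 1 := by omega
  simp only [antichainSet, Set.mem_ofPred_eq, e₁, e₂] at h₀ h₁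
  simp at h₀ h₁
  tauto

theorem exists_uncountable_omegaUScrambledSet [Finite X] [Countable Γ] [Nontrivial X]
    (h : ∃ θ, ¬ QuasiPeriodic φ θ) :
    ∃ A : Set (Γ → X), ¬ A.Countable ∧ OmegaUScrambledSet (genShift φ) A := by
  obtain ⟨θ, hθ⟩ := h
  obtain ⟨p, q, hpq⟩ := exists_pair_ne X
  let P : Set ℕ → Γ → X := fun B => orbitPoint φ θ p q (patternSet (antichainSet B))
  have hP : ∀ B C, B ≠ C → OmegaUScrambled (genShift φ) (P B) (P C) := fun B C hBC =>
    omegaUScrambled_orbitPoint hθ hpq (not_antichainSet_subset hBC)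
  have hinj : Function.Injective P := by
    intro B C hBC
    by_contra hne
    have := (hP B C hne).1
    simp [hBC] at this
  refine ⟨Set.range P, not_countable_range_of_injective hinj,
    ⟨P ∅, ⟨_, rfl⟩, P Set.univ, ⟨_, rfl⟩, hinj.ne Set.empty_ne_univ⟩, ?_⟩
  rintro _ ⟨B, rfl⟩ _ ⟨C, rfl⟩ hne
  exact hP B C fun hBC => hne (congrArg P hBC)

end OrbitPoint

variable {X : Type*} [Fintype X] [TopologicalSpace X] [DiscreteTopology X] [Nontrivial X]
variable {Γ : Type*} [Countable Γ] [Nonempty Γ]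
/-- `(X^Γ, σ_φ)` is `ω_u^u`- (resp. `ω^u_∞`-, `ω^u_2`-, `ω_∞^∞`-, `ω_2^∞`-)
chaotic iff `φ` has at least one non-quasi-periodic point. -/
theorem omegaChaotic_iff_exists_not_quasiPeriodic (φ : Γ → Γ) :
    ((∃ A : Set (Γ → X), ¬ A.Countable ∧ OmegaUScrambledSet (genShift (X := X) φ) A) ↔
        (∃ θ : Γ, ¬ QuasiPeriodic φ θ)) ∧
    ((∃ A : Set (Γ → X), A.Infinite ∧ OmegaUScrambledSet (genShift (X := X) φ) A) ↔
        (∃ θ : Γ, ¬ QuasiPeriodic φ θ)) ∧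
    ((∃ A : Set (Γ → X), OmegaUScrambledSet (genShift (X := X) φ) A) ↔
        (∃ θ : Γ, ¬ QuasiPeriodic φ θ)) ∧
    ((∃ A : Set (Γ → X), A.Infinite ∧ OmegaInfScrambledSet (genShift (X := X) φ) A) ↔
        (∃ θ : Γ, ¬ QuasiPeriodic φ θ)) ∧
    ((∃ A : Set (Γ → X), OmegaInfScrambledSet (genShift (X := X) φ) A) ↔
        (∃ θ : Γ, ¬ QuasiPeriodic φ θ)) := by
  have huncountable : (∃ θ : Γ, ¬ QuasiPeriodic φ θ) →
      ∃ A : Set (Γ → X), ¬ A.Countable ∧ OmegaUScrambledSet (genShift (X := X) φ) A :=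
    exists_uncountable_omegaUScrambledSet
  have hinfinite : (∃ θ : Γ, ¬ QuasiPeriodic φ θ) →
      ∃ A : Set (Γ → X), A.Infinite ∧ OmegaUScrambledSet (genShift (X := X) φ) A := fun h =>
    let ⟨A, hA, hs⟩ := huncountable h
    ⟨A, fun hfin => hA hfin.countable, hs⟩
  refine ⟨⟨?_, huncountable⟩, ⟨?_, hinfinite⟩, ⟨?_, fun h => ?_⟩, ⟨?_, fun h => ?_⟩,
    ⟨?_, fun h => ?_⟩⟩
  · rintro ⟨A, -, hs⟩
    exact exists_not_quasiPeriodic_of_omegaInfScrambledSet hs.omegaInfScrambledSet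
  · rintro ⟨A, -, hs⟩
    exact exists_not_quasiPeriodic_of_omegaInfScrambledSet hs.omegaInfScrambledSet
  · rintro ⟨A, hs⟩
    exact exists_not_quasiPeriodic_of_omegaInfScrambledSet hs.omegaInfScrambledSet
  · obtain ⟨A, -, hs⟩ := hinfinite h
    exact ⟨A, hs⟩
  · rintro ⟨A, -, hs⟩
    exact exists_not_quasiPeriodic_of_omegaInfScrambledSet hs
  · obtain ⟨A, hA, hs⟩ := hinfinite h
    exact ⟨A, hA, hs.omegaInfScrambledSet⟩
  · rintro ⟨A, hs⟩
    exact exists_not_quasiPeriodic_of_omegaInfScrambledSet hs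
  · obtain ⟨A, -, hs⟩ := hinfinite h
    exact ⟨A, hs.omegaInfScrambledSet⟩
end

section
/- Let d be any compatible metric on X^Γ and compute F and F* with respect to f = σ_φ. For every s > 0 there exists r > 0 such that for all x = (x_α), y = (y_α), z = (z_α) ∈ X^Γ: if the set {α ∈ Γ : x_α ≠ z_α} is a finite set consisting of non-quasi-periodic points of φ, then F*_{xy}(r) ≤ F*_{zy}(s) and F_{xy}(r) ≤ F_{zy}(s). -/
open Filter Topology

theorem genShift_iterate {X Γ : Type*} (φ : Γ → Γ) (i : ℕ) (x : Γ → X) (α : Γ) :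
    (genShift φ)^[i] x α = x (φ^[i] α) := by
  induction i generalizing α with
  | zero => rfl
  | succ i ih => rw [Function.iterate_succ_apply', genShift, ih, Function.iterate_succ_apply]

theorem QuasiPeriodic.of_isPeriodicPt {Γ : Type*} {φ : Γ → Γ} {θ : Γ} {m : ℕ} (hm : 0 < m)
    (h : Function.IsPeriodicPt φ m θ) : QuasiPeriodic φ θ := by
  refine ((Set.finite_lt_nat m).image fun n => φ^[n] θ).subset ?_
  rintro _ ⟨n, rfl⟩
  exact ⟨n % m, Nat.mod_lt n hm, h.iterate_mod_apply n⟩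

theorem subsingleton_iterate_eq_of_not_quasiPeriodic {Γ : Type*} {φ : Γ → Γ} {θ : Γ}
    (hθ : ¬ QuasiPeriodic φ θ) (α : Γ) : {i : ℕ | φ^[i] α = θ}.Subsingleton := by
  have key : ∀ i j : ℕ, φ^[i] α = θ → φ^[j] α = θ → ¬ i < j := by
    intro i j hi hj hij
    refine hθ (.of_isPeriodicPt (Nat.sub_pos_of_lt hij) ?_)
    rw [Function.IsPeriodicPt, Function.IsFixedPt]
    conv_lhs => rw [← hi]
    rw [← Function.iterate_add_apply, Nat.sub_add_cancel hij.le, hj]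
  intro i hi j hj
  exact le_antisymm (not_lt.1 (key j i hj hi)) (not_lt.1 (key i j hi hj))

/-- Two points differing at finitely many non-quasi-periodic coordinates have orbits that
eventually agree at each coordinate. -/
theorem eventually_genShift_iterate_eq {X Γ : Type*} {φ : Γ → Γ} {x z : Γ → X}
    (hfin : {α : Γ | x α ≠ z α}.Finite) (hqp : ∀ α, x α ≠ z α → ¬ QuasiPeriodic φ α) (α : Γ) :
    ∀ᶠ i in atTop, (genShift φ)^[i] x α = (genShift φ)^[i] z α := by
  have hbad : {i : ℕ | x (φ^[i] α) ≠ z (φ^[i] α)}.Finite := by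
    refine (hfin.biUnion fun β hβ =>
      (subsingleton_iterate_eq_of_not_quasiPeriodic (hqp β hβ) α).finite).subset ?_
    intro i hi
    exact Set.mem_biUnion (x := φ^[i] α) hi rfl
  rw [← Nat.cofinite_eq_atTop]
  refine hbad.subset fun i hi => ?_
  simpa only [Set.mem_compl_iff, Set.mem_ofPred_eq, genShift_iterate] using hi

theorem IsCompatibleMetric.tendsto_of_tendsto_uniformity {Y ι : Type*} [u : UniformSpace Y]
    [CompactSpace Y] {d : Y → Y → ℝ} (hd : IsCompatibleMetric Y d) {l : Filter ι} {a b : ι → Y}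
    (h : Tendsto (fun i => (a i, b i)) l (uniformity Y)) :
    Tendsto (fun i => d (a i) (b i)) l (𝓝 0) := by
  obtain ⟨m, hm, hdist⟩ := hd
  obtain rfl : u = m.toUniformSpace := unique_uniformity_of_compact rfl hm
  simp only [← hdist]
  rw [Metric.uniformity_eq_comap_nhds_zero, tendsto_comap_iff] at h
  exact h

theorem IsCompatibleMetric.tendsto_of_eventually_eq {X Γ ι : Type*} [Finite X]
    [t : TopologicalSpace X] [DiscreteTopology X] {d : (Γ → X) → (Γ → X) → ℝ}
    (hd : IsCompatibleMetric (Γ → X) d) {l : Filter ι} {a b : ι → Γ → X}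
    (h : ∀ α, ∀ᶠ i in l, a i α = b i α) : Tendsto (fun i => d (a i) (b i)) l (𝓝 0) := by
  obtain rfl : t = ⊥ := DiscreteTopology.eq_bot
  let _ : UniformSpace X := ⊥
  refine IsCompatibleMetric.tendsto_of_tendsto_uniformity hd ?_
  rw [Pi.uniformity, tendsto_iInf]
  refine fun α => tendsto_comap_iff.2 fun s hs => ?_
  exact (h α).mono fun i hi => mem_uniformity_of_eq hs hi

theorem xiCount_div_mem_Icc {Y : Type*} (d : Y → Y → ℝ) (f : Y → Y) (x y : Y) (t : ℝ) (n : ℕ) :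
    (xiCount d f x y t n : ℝ) / n ∈ Set.Icc (0 : ℝ) 1 := by
  refine ⟨by positivity, div_le_one_of_le₀ (Nat.cast_le.2 ?_) n.cast_nonneg⟩
  calc xiCount d f x y t n ≤ {i : ℕ | i < n}.ncard :=
        Set.ncard_le_ncard (fun i hi => hi.1) (Set.finite_lt_nat n)
    _ = n := Set.ncard_Iio_nat n

theorem xiCount_le_add {Y : Type*} {d : Y → Y → ℝ} {f : Y → Y} {x y z : Y} {r s : ℝ} {N : ℕ}
    (h : ∀ i ≥ N, d (f^[i] x) (f^[i] y) < r → d (f^[i] z) (f^[i] y) < s) (n : ℕ) :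
    xiCount d f x y r n ≤ xiCount d f z y s n + N := by
  have hsub : {i : ℕ | i < n ∧ d (f^[i] x) (f^[i] y) < r} ⊆
      {i : ℕ | i < n ∧ d (f^[i] z) (f^[i] y) < s} ∪ {i : ℕ | i < N} := by
    rintro i ⟨hin, hi⟩
    by_cases hN : i < N
    · exact .inr hN
    · exact .inl ⟨hin, h i (not_lt.1 hN) hi⟩
  have hfin : {i : ℕ | i < n ∧ d (f^[i] z) (f^[i] y) < s}.Finite :=
    (Set.finite_lt_nat n).subset fun i hi => hi.1
  calc xiCount d f x y r n ≤ _ := Set.ncard_le_ncard hsub (hfin.union (Set.finite_lt_nat N))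
    _ ≤ _ := Set.ncard_union_le _ _
    _ = _ := by rw [show {i : ℕ | i < N}.ncard = N from Set.ncard_Iio_nat N]; rfl

/-- For sequences in `[0, 1]`, an eventual bound `u ≤ v + ε` for every `ε > 0` passes to the upper
and lower limits. -/
theorem limsup_le_and_liminf_le_of_eventually_le_add {u v : ℕ → ℝ}
    (hu : ∀ n, u n ∈ Set.Icc (0 : ℝ) 1) (hv : ∀ n, v n ∈ Set.Icc (0 : ℝ) 1)
    (h : ∀ ε > 0, ∀ᶠ n in atTop, u n ≤ v n + ε) :
    limsup u atTop ≤ limsup v atTop ∧ liminf u atTop ≤ liminf v atTop := by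
  have above {w : ℕ → ℝ} {c : ℝ} (hw : ∀ n, w n ≤ c) : IsBoundedUnder (· ≤ ·) atTop w :=
    isBoundedUnder_of ⟨c, hw⟩
  have below {w : ℕ → ℝ} {c : ℝ} (hw : ∀ n, c ≤ w n) : IsBoundedUnder (· ≥ ·) atTop w :=
    isBoundedUnder_of ⟨c, hw⟩
  have hv₀ := below fun n => (hv n).1
  have hv₁ := above fun n => (hv n).2
  have hu₀ := below fun n => (hu n).1
  constructor
  · refine le_of_forall_pos_le_add fun ε hε => ?_
    rw [← limsup_add_const atTop v ε hv₁ hv₀.isCoboundedUnder_le]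
    exact limsup_le_limsup (h ε hε) hu₀.isCoboundedUnder_le
      (above fun n => add_le_add_left (hv n).2 ε)
  · refine le_of_forall_pos_le_add fun ε hε => ?_
    rw [← liminf_add_const atTop v ε hv₁.isCoboundedUnder_ge hv₀]
    exact liminf_le_liminf (h ε hε) hu₀
      (above fun n => add_le_add_left (hv n).2 ε).isCoboundedUnder_ge

theorem FdistStar_le_and_Fdist_le_of_eventually {Y : Type*} {d : Y → Y → ℝ} {f : Y → Y}
    {x y z : Y} {r s : ℝ}
    (h : ∀ᶠ i in atTop, d (f^[i] x) (f^[i] y) < r → d (f^[i] z) (f^[i] y) < s) :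
    FdistStar d f x y r ≤ FdistStar d f z y s ∧ Fdist d f x y r ≤ Fdist d f z y s := by
  obtain ⟨N, hN⟩ := eventually_atTop.1 h
  refine limsup_le_and_liminf_le_of_eventually_le_add (xiCount_div_mem_Icc d f x y r)
    (xiCount_div_mem_Icc d f z y s) fun ε hε => ?_
  filter_upwards [(tendsto_const_div_atTop_nhds_zero_nat (N : ℝ)).eventually_lt_const hε] with n hn
  calc (xiCount d f x y r n : ℝ) / n ≤ (xiCount d f z y s n + N : ℝ) / n := by
        gcongr
        exact_mod_cast xiCount_le_add hN n
    _ = (xiCount d f z y s n : ℝ) / n + N / n := add_div _ _ _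
    _ ≤ (xiCount d f z y s n : ℝ) / n + ε := by gcongr

variable {X : Type*} [Fintype X] [TopologicalSpace X] [DiscreteTopology X] [Nontrivial X]
variable {Γ : Type*} [Countable Γ] [Nonempty Γ]
/-- for any compatible metric `d` on `X^Γ` (with `F`, `F*` computed for
`f = σ_φ`): for every `s > 0` there is `r > 0` such that whenever `x, y, z ∈ X^Γ` and
`{α : x_α ≠ z_α}` is a finite set of non-quasi-periodic points of `φ`, then
`F*_{xy}(r) ≤ F*_{zy}(s)` and `F_{xy}(r) ≤ F_{zy}(s)`. -/
theorem F_le_of_finite_diff_on_nonQuasiPeriodic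
    (φ : Γ → Γ)
    (d : (Γ → X) → (Γ → X) → ℝ) (hd : IsCompatibleMetric (Γ → X) d) :
    ∀ s > (0 : ℝ), ∃ r > (0 : ℝ), ∀ x y z : Γ → X,
      ({α : Γ | x α ≠ z α}.Finite ∧ ∀ α : Γ, x α ≠ z α → ¬ QuasiPeriodic φ α) →
        FdistStar d (genShift (X := X) φ) x y r ≤ FdistStar d (genShift (X := X) φ) z y s ∧
        Fdist d (genShift (X := X) φ) x y r ≤ Fdist d (genShift (X := X) φ) z y s := by
  intro s hs
  refine ⟨s / 2, half_pos hs, fun x y z ⟨hfin, hqp⟩ => ?_⟩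
  have hlim := hd.tendsto_of_eventually_eq (eventually_genShift_iterate_eq hfin hqp)
  refine FdistStar_le_and_Fdist_le_of_eventually ?_
  filter_upwards [hlim.eventually_lt_const (half_pos hs)] with i hxz hxy
  obtain ⟨m, -, hdist⟩ := hd
  rw [← hdist] at *
  have := dist_triangle_left ((genShift φ)^[i] z) ((genShift φ)^[i] y) ((genShift φ)^[i] x)
  linarith
end
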